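/- Let F be a field of characteristic 0, let q_1 q_2 ⋯ q_n be any sequence with each q_k ∈ {A, S}, and let t ≥ 1 be an integer. Then the sequence of length n + t consisting of q_1 q_2 ⋯ q_n followed by t copies of N is attainable over F, i.e., it is the qpr-sequence of some (n+t)×(n+t) symmetric matrix over F. -/

import Mathlib

open Matrix

/-- The minor of a square matrix `B` lying in the rows indexed by `α` and the columns
indexed by `β` (each listed in increasing order); junk value `0` if `α.card ≠ β.card`. -/
def qMinor {R : Type*} [CommRing R] {m : Type*} [Fintype m] [LinearOrder m]
    (B : Matrix m m R) (α β : Finset m) : R :=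
  if h : β.card = α.card then
    (Matrix.of fun i j : Fin α.card =>
      B (α.orderEmbOfFin rfl i) (β.orderEmbOfFin h j)).det
  else 0

/-- `α` and `β` index a quasi-principal submatrix of order `k`, i.e.
`|α| = |β| = k` and `k - 1 ≤ |α ∩ β| (≤ k)`. -/
def IsQPPair {m : Type*} [DecidableEq m] (k : ℕ) (α β : Finset m) : Prop :=
  α.card = k ∧ β.card = k ∧ k - 1 ≤ (α ∩ β).card

/-- All quasi-principal minors of `B` of order `k` are nonzero. -/
def QPAllNonzero {R : Type*} [CommRing R] {m : Type*} [Fintype m] [LinearOrder m]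
    (B : Matrix m m R) (k : ℕ) : Prop :=
  ∀ α β : Finset m, IsQPPair k α β → qMinor B α β ≠ 0

/-- All quasi-principal minors of `B` of order `k` are zero. -/
def QPAllZero {R : Type*} [CommRing R] {m : Type*} [Fintype m] [LinearOrder m]
    (B : Matrix m m R) (k : ℕ) : Prop :=
  ∀ α β : Finset m, IsQPPair k α β → qMinor B α β = 0

/-- The three possible letters of a qpr-sequence. -/
inductive QPR : Type
  | A
  | S
  | N
deriving DecidableEq

open Classical in
/-- The letter of the qpr-sequence of `B` corresponding to order `k`:
`A` if all quasi-principal minors of order `k` are nonzero, `N` if all are zero,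
and `S` otherwise. -/
noncomputable def qprEntry {R : Type*} [CommRing R] {m : Type*} [Fintype m] [LinearOrder m]
    (B : Matrix m m R) (k : ℕ) : QPR :=
  if QPAllNonzero B k then QPR.A
  else if QPAllZero B k then QPR.N
  else QPR.S

/-- A sequence of letters `q 0, …, q (n-1)` (standing for `q_1 ⋯ q_n`) is attainable
over `F` if it is the qpr-sequence of an `n × n` symmetric matrix over `F`. -/
def Attainable (F : Type*) [Field F] {n : ℕ} (q : Fin n → QPR) : Prop :=
  ∃ B : Matrix (Fin n) (Fin n) F, B.IsSymm ∧ ∀ k : Fin n, qprEntry B ((k : ℕ) + 1) = q k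

/-- The Schur complement `B/B[γ] = B[γᶜ] - B[γᶜ, γ] B[γ]⁻¹ B[γ, γᶜ]`,
with rows and columns indexed by `γᶜ` (indexing inherited from `B`). -/
noncomputable def schurCompl {R : Type*} [CommRing R] {n : ℕ}
    (B : Matrix (Fin n) (Fin n) R) (γ : Finset (Fin n)) :
    Matrix ↥(γᶜ) ↥(γᶜ) R :=
  B.submatrix (fun i : ↥(γᶜ) => (i : Fin n)) (fun j : ↥(γᶜ) => (j : Fin n)) -
    B.submatrix (fun i : ↥(γᶜ) => (i : Fin n)) (fun j : ↥γ => (j : Fin n)) *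
      (B.submatrix (fun i : ↥γ => (i : Fin n)) fun j : ↥γ => (j : Fin n))⁻¹ *
      B.submatrix (fun i : ↥γ => (i : Fin n)) fun j : ↥(γᶜ) => (j : Fin n)

/-- The `(m+1) × (m+1)` matrix with block form `[[A, x], [yᵀ, b]]`. -/
def borderMat {R : Type*} [CommRing R] {m : ℕ} (A : Matrix (Fin m) (Fin m) R)
    (x y : Fin m → R) (b : R) : Matrix (Fin (m + 1)) (Fin (m + 1)) R :=
  Matrix.of fun i j =>
    if hi : (i : ℕ) < m then
      if hj : (j : ℕ) < m then A ⟨i, hi⟩ ⟨j, hj⟩ else x ⟨i, hi⟩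
    else
      if hj : (j : ℕ) < m then y ⟨j, hj⟩ else b

/-- At most one entry of `f` is not an entry of `g`. -/
def Sub1 {k l : ℕ} {m : Type*} (f : Fin k → m) (g : Fin l → m) : Prop :=
  ∀ i l, i ≠ l → (∃ j, g j = f i) ∨ ∃ j, g j = f l

/-- `f`, `g` list the rows and columns of a quasi-principal submatrix. -/
def QP {k : ℕ} {m : Type*} (f g : Fin k → m) : Prop :=
  Function.Injective f ∧ Function.Injective g ∧ Sub1 f g ∧ Sub1 g f

theorem QP.symm {k : ℕ} {m : Type*} {f g : Fin k → m} (h : QP f g) : QP g f :=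
  ⟨h.2.1, h.1, h.2.2.2, h.2.2.1⟩

theorem Sub1.perm {k : ℕ} {m : Type*} {f g : Fin k → m} (h : Sub1 f g)
    (σ τ : Equiv.Perm (Fin k)) : Sub1 (f ∘ σ) (g ∘ τ) := by
  intro i i' hi
  rcases h (σ i) (σ i') (by simpa using hi) with ⟨j, hj⟩ | ⟨j, hj⟩
  · exact Or.inl ⟨τ.symm j, by simpa using hj⟩
  · exact Or.inr ⟨τ.symm j, by simpa using hj⟩

theorem QP.perm {k : ℕ} {m : Type*} {f g : Fin k → m} (h : QP f g) (σ τ : Equiv.Perm (Fin k)) :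
    QP (f ∘ σ) (g ∘ τ) :=
  ⟨h.1.comp σ.injective, h.2.1.comp τ.injective, h.2.2.1.perm σ τ, h.2.2.2.perm τ σ⟩

theorem det_perm_ne {k : ℕ} {m R : Type*} [CommRing R] (B : Matrix m m R) (f g : Fin k → m)
    (σ τ : Equiv.Perm (Fin k)) :
    (B.submatrix (f ∘ σ) (g ∘ τ)).det = 0 ↔ (B.submatrix f g).det = 0 := by
  have h : B.submatrix (f ∘ σ) (g ∘ τ) = ((B.submatrix f g).submatrix σ id).submatrix id τ := rfl
  rw [h, Matrix.det_permute', Matrix.det_permute]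
  rcases Int.units_eq_one_or (Equiv.Perm.sign σ) with h1 | h1 <;>
  rcases Int.units_eq_one_or (Equiv.Perm.sign τ) with h2 | h2 <;> simp [h1, h2]

/-- The bordered matrix `[[1, xᵀ], [x, C + x xᵀ]]`. -/
def bm {R : Type*} [CommRing R] {N : ℕ} (C : Matrix (Fin N) (Fin N) R) (x : Fin N → R) :
    Matrix (Fin (N + 1)) (Fin (N + 1)) R :=
  Matrix.of fun i j => Fin.cases (Fin.cases 1 x j)
    (fun i' => Fin.cases (x i') (fun j' => C i' j' + x i' * x j') j) i

section bm
variable {R : Type*} [CommRing R] {N : ℕ} (C : Matrix (Fin N) (Fin N) R) (x : Fin N → R)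

@[simp] theorem bm_00 : bm C x 0 0 = 1 := rfl
@[simp] theorem bm_0s (j : Fin N) : bm C x 0 j.succ = x j := rfl
@[simp] theorem bm_s0 (j : Fin N) : bm C x j.succ 0 = x j := rfl
@[simp] theorem bm_ss (i j : Fin N) : bm C x i.succ j.succ = C i j + x i * x j := rfl

theorem bm_symm (h : C.IsSymm) : (bm C x).IsSymm := by
  ext i j
  refine Fin.cases ?_ (fun i => ?_) i <;> refine Fin.cases ?_ (fun j => ?_) j <;> simp
  rw [h.apply, mul_comm]

/-- Minors with first index in both rows and columns. -/
theorem det_both {k : ℕ} (f g : Fin k → Fin N) :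
    ((bm C x).submatrix (Fin.cons 0 (Fin.succ ∘ f)) (Fin.cons 0 (Fin.succ ∘ g))).det
      = (C.submatrix f g).det := by
  rw [Matrix.det_eq_of_forall_row_eq_smul_add_const (B := Matrix.of fun i j : Fin (k + 1) =>
      Fin.cases (Fin.cases 1 (x ∘ g) j) (fun i' => Fin.cases 0 (fun j' => C (f i') (g j')) j) i)
      (Fin.cons 0 (x ∘ f) : Fin (k + 1) → R) 0 rfl]
  · rw [Matrix.det_succ_column_zero, Fin.sum_univ_succ]
    simp
    rfl
  · intro i j
    refine Fin.cases ?_ (fun i => ?_) i <;> refine Fin.cases ?_ (fun j => ?_) j <;> simp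

/-- Minors with first index in the rows only. -/
theorem det_row {k : ℕ} (f : Fin k → Fin N) (g : Fin (k + 1) → Fin N) (b : Fin (k + 1))
    (hx : ∀ j, x (g j) = (Pi.single b 1 : Fin (k + 1) → R) j) :
    ((bm C x).submatrix (Fin.cons 0 (Fin.succ ∘ f)) (Fin.succ ∘ g)).det
      = (-1) ^ (b : ℕ) * (C.submatrix f (g ∘ b.succAbove)).det := by
  rw [Matrix.det_eq_of_forall_row_eq_smul_add_const (B := Matrix.of fun i j : Fin (k + 1) =>
      Fin.cases (x (g j)) (fun i' => C (f i') (g j)) i)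
      (Fin.cons 0 (x ∘ f) : Fin (k + 1) → R) 0 rfl]
  · rw [Matrix.det_succ_row_zero, Finset.sum_eq_single b]
    · simp [hx]
      rfl
    · intro j _ hj
      simp [hx, hj]
    · simp
  · intro i j
    refine Fin.cases ?_ (fun i => ?_) i <;> simp

/-- Minors without the first index. -/
theorem det_none {k : ℕ} (f g : Fin (k + 1) → Fin N) (a b : Fin (k + 1))
    (hf : ∀ j, x (f j) = (Pi.single a 1 : Fin (k + 1) → R) j)
    (hg : ∀ j, x (g j) = (Pi.single b 1 : Fin (k + 1) → R) j) :
    ((bm C x).submatrix (Fin.succ ∘ f) (Fin.succ ∘ g)).det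
      = (C.submatrix f g).det
        + (-1) ^ (a + b : ℕ) * (C.submatrix (f ∘ a.succAbove) (g ∘ b.succAbove)).det := by
  have h : (bm C x).submatrix (Fin.succ ∘ f) (Fin.succ ∘ g) =
      (C.submatrix f g).updateRow a (C.submatrix f g a + Pi.single b 1) := by
    ext i j
    by_cases hi : i = a
    · subst hi
      simp [hf, hg]
    · simp [hf, hi]
  rw [h, Matrix.det_updateRow_add, Matrix.updateRow_eq_self, ← Matrix.adjugate_apply,
    Matrix.adjugate_fin_succ_eq_det_submatrix]
  rfl

theorem det_none_zero {k : ℕ} (f g : Fin k → Fin N) :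
    ((bm C 0).submatrix (Fin.succ ∘ f) (Fin.succ ∘ g)).det = (C.submatrix f g).det := by
  congr 1
  ext i j
  simp

end bm

theorem fin_decomp {k N : ℕ} (f : Fin (k + 1) → Fin (N + 1)) (hf : Function.Injective f) :
    (∃ f' : Fin (k + 1) → Fin N, f = Fin.succ ∘ f') ∨
    ∃ (σ : Equiv.Perm (Fin (k + 1))) (f' : Fin k → Fin N),
      f ∘ σ = Fin.cons 0 (Fin.succ ∘ f') := by
  by_cases h : ∃ a, f a = 0
  · right
    obtain ⟨a, ha⟩ := h
    have h2 : ∀ i : Fin k, f (Equiv.swap 0 a i.succ) ≠ 0 := by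
      intro i hi
      have h3 := hf (hi.trans ha.symm)
      rw [Equiv.swap_apply_eq_iff] at h3
      simp at h3
    refine ⟨Equiv.swap 0 a, fun i => (f (Equiv.swap 0 a i.succ)).pred (h2 i), ?_⟩
    ext i
    refine Fin.cases ?_ (fun i => ?_) i
    · simp [ha]
    · simp
  · left
    push Not at h
    refine ⟨fun i => (f i).pred (h i), ?_⟩
    ext i
    simp

theorem cons_inj_iff {k N : ℕ} (f : Fin k → Fin N) :
    Function.Injective (Fin.cons 0 (Fin.succ ∘ f) : Fin (k + 1) → Fin (N + 1)) ↔
      Function.Injective f := by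
  rw [Fin.cons_injective_iff]
  constructor
  · rintro ⟨-, h⟩
    exact h.of_comp
  · intro h
    refine ⟨?_, (Fin.succ_injective N).comp h⟩
    rintro ⟨i, hi⟩
    simp at hi

theorem Sub1.cons_iff {k N : ℕ} (f g : Fin k → Fin N) :
    Sub1 (Fin.cons 0 (Fin.succ ∘ f) : Fin (k + 1) → Fin (N + 1))
      (Fin.cons 0 (Fin.succ ∘ g) : Fin (k + 1) → Fin (N + 1)) ↔ Sub1 f g := by
  constructor
  · intro h i i' hi
    have := h i.succ i'.succ (by simpa using hi)
    simpa [Fin.exists_fin_succ, (Fin.succ_ne_zero _).symm] using this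
  · intro h i i'
    refine Fin.cases ?_ (fun i => ?_) i
    · intro _
      exact Or.inl ⟨0, rfl⟩
    refine Fin.cases ?_ (fun i' => ?_) i'
    · intro _
      exact Or.inr ⟨0, rfl⟩
    intro hi
    have := h i i' (by simpa using hi)
    simpa [Fin.exists_fin_succ, (Fin.succ_ne_zero _).symm] using this

theorem QP.cons_iff {k N : ℕ} (f g : Fin k → Fin N) :
    QP (Fin.cons 0 (Fin.succ ∘ f) : Fin (k + 1) → Fin (N + 1))
      (Fin.cons 0 (Fin.succ ∘ g) : Fin (k + 1) → Fin (N + 1)) ↔ QP f g := by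
  simp only [QP, cons_inj_iff, Sub1.cons_iff]

theorem QP.succ_iff {k N : ℕ} (f g : Fin k → Fin N) :
    QP (Fin.succ ∘ f) (Fin.succ ∘ g) ↔ QP f g := by
  simp [QP, Sub1, (Fin.succ_injective N).of_comp_iff]

theorem QP.of_row {k N : ℕ} (f : Fin k → Fin N) (g : Fin (k + 1) → Fin N)
    (h : QP (Fin.cons 0 (Fin.succ ∘ f) : Fin (k + 1) → Fin (N + 1)) (Fin.succ ∘ g))
    (b : Fin (k + 1)) : QP f (g ∘ b.succAbove) := by
  obtain ⟨hf, hg, h1, h2⟩ := h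
  have hf' := (cons_inj_iff f).1 hf
  have hg' : Function.Injective g := hg.of_comp
  have h3 : ∀ i, ∃ j, g j = f i := by
    intro i
    simpa using h1 0 i.succ (Fin.succ_ne_zero _).symm
  refine ⟨hf', hg'.comp Fin.succAbove_right_injective, ?_, ?_⟩
  · intro i i' hi
    obtain ⟨j, hj⟩ := h3 i
    obtain ⟨j', hj'⟩ := h3 i'
    by_cases hb : j = b
    · have : j' ≠ b := by
        rintro rfl
        apply hi
        apply hf'
        rw [← hj, ← hj', hb]
      obtain ⟨l, rfl⟩ := Fin.exists_succAbove_eq this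
      exact Or.inr ⟨l, hj'⟩
    · obtain ⟨l, rfl⟩ := Fin.exists_succAbove_eq hb
      exact Or.inl ⟨l, hj⟩
  · intro i i' hi
    have := h2 (b.succAbove i) (b.succAbove i') (by simpa using hi)
    simpa [Fin.exists_fin_succ, (Fin.succ_ne_zero _).symm] using this

theorem Sub1.remove_common {k N : ℕ} {f g : Fin (k + 1) → Fin N} (h : Sub1 f g)
    (hf : Function.Injective f) {a b : Fin (k + 1)} (hab : f a = g b) :
    Sub1 (f ∘ a.succAbove) (g ∘ b.succAbove) := by
  have key : ∀ i, (∃ j, g j = f (a.succAbove i)) → ∃ j, g (b.succAbove j) = f (a.succAbove i) := by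
    rintro i ⟨j, hj⟩
    have : j ≠ b := by
      rintro rfl
      rw [← hab] at hj
      exact Fin.succAbove_ne a i (hf hj).symm
    obtain ⟨l, rfl⟩ := Fin.exists_succAbove_eq this
    exact ⟨l, hj⟩
  intro i l hi
  exact (h (a.succAbove i) (a.succAbove l) (by simpa using hi)).imp (key i) (key l)

theorem Sub1.remove_diff {k N : ℕ} {f g : Fin (k + 1) → Fin N} (h : Sub1 f g)
    {a b : Fin (k + 1)} (hb : ∀ i, f i ≠ g b) :
    Sub1 (f ∘ a.succAbove) (g ∘ b.succAbove) := by
  have key : ∀ i, (∃ j, g j = f (a.succAbove i)) → ∃ j, g (b.succAbove j) = f (a.succAbove i) := by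
    rintro i ⟨j, hj⟩
    have : j ≠ b := by
      rintro rfl
      exact hb _ hj.symm
    obtain ⟨l, rfl⟩ := Fin.exists_succAbove_eq this
    exact ⟨l, hj⟩
  intro i l hi
  exact (h (a.succAbove i) (a.succAbove l) (by simpa using hi)).imp (key i) (key l)

/-- All quasi-principal minors of order `k` are nonzero. -/
def NZ {R : Type*} [CommRing R] {m : Type*} (k : ℕ) (C : Matrix m m R) : Prop :=
  ∀ f g : Fin k → m, QP f g → (C.submatrix f g).det ≠ 0

theorem exists_x_row {F : Type*} [Field F] {N k : ℕ} {C : Matrix (Fin N) (Fin N) F}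
    (hC : NZ k C) (P : Fin N → Prop)
    (hP : ∀ f : Fin (k + 1) → Fin N, Function.Injective f → ∃ a, P (f a))
    (f : Fin k → Fin N) (g : Fin (k + 1) → Fin N)
    (h : QP (Fin.cons 0 (Fin.succ ∘ f) : Fin (k + 1) → Fin (N + 1)) (Fin.succ ∘ g)) :
    ∃ x : Fin N → F, (∀ i, ¬ P i → x i = 0) ∧
      ((bm C x).submatrix (Fin.cons 0 (Fin.succ ∘ f)) (Fin.succ ∘ g)).det ≠ 0 := by
  have hg : Function.Injective g := h.2.1.of_comp
  obtain ⟨b, hb⟩ := hP g hg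
  refine ⟨Pi.single (g b) 1, ?_, ?_⟩
  · intro i hi
    rw [Pi.single_apply, if_neg]
    rintro rfl
    exact hi hb
  · rw [det_row C _ f g b]
    · exact mul_ne_zero (by simp) (hC _ _ (h.of_row f g b))
    · intro j
      simp [Pi.single_apply, hg.eq_iff]

theorem exists_x_none {F : Type*} [Field F] {N k : ℕ} {C : Matrix (Fin N) (Fin N) F}
    (hC : NZ k C) (P : Fin N → Prop)
    (hP : ∀ f : Fin (k + 1) → Fin N, Function.Injective f → ∃ a, P (f a))
    (f g : Fin (k + 1) → Fin N) (h : QP f g) :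
    ∃ x : Fin N → F, (∀ i, ¬ P i → x i = 0) ∧
      ((bm C x).submatrix (Fin.succ ∘ f) (Fin.succ ∘ g)).det ≠ 0 := by
  obtain ⟨hf, hg, h1, h2⟩ := h
  by_cases h0 : (C.submatrix f g).det = 0
  swap
  · exact ⟨0, by simp, by rwa [det_none_zero]⟩
  by_cases hr : ∃ a b, f a = g b ∧ P (f a)
  · obtain ⟨a, b, hab, hPa⟩ := hr
    refine ⟨Pi.single (f a) 1, ?_, ?_⟩
    · intro i hi
      rw [Pi.single_apply, if_neg]
      rintro rfl
      exact hi hPa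
    · rw [det_none C _ f g a b, h0, zero_add]
      · refine mul_ne_zero (by simp) (hC _ _ ⟨?_, ?_, ?_, ?_⟩)
        · exact hf.comp Fin.succAbove_right_injective
        · exact hg.comp Fin.succAbove_right_injective
        · exact h1.remove_common hf hab
        · exact h2.remove_common hg hab.symm
      · intro j
        simp [Pi.single_apply, hf.eq_iff]
      · intro j
        simp [Pi.single_apply, hab, hg.eq_iff]
  · push Not at hr
    obtain ⟨a, ha⟩ := hP f hf
    obtain ⟨b, hb⟩ := hP g hg
    have ha' : ∀ j, g j ≠ f a := fun j hj => hr a j hj.symm ha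
    have hb' : ∀ j, f j ≠ g b := fun j hj => hr j b hj (hj ▸ hb)
    refine ⟨Pi.single (f a) 1 + Pi.single (g b) 1, ?_, ?_⟩
    · intro i hi
      rw [Pi.add_apply, Pi.single_apply, if_neg, Pi.single_apply, if_neg, add_zero]
      · rintro rfl
        exact hi hb
      · rintro rfl
        exact hi ha
    · rw [det_none C _ f g a b, h0, zero_add]
      · refine mul_ne_zero (by simp) (hC _ _ ⟨?_, ?_, ?_, ?_⟩)
        · exact hf.comp Fin.succAbove_right_injective
        · exact hg.comp Fin.succAbove_right_injective
        · exact h1.remove_diff hb'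
        · exact h2.remove_diff ha'
      · intro j
        simp [Pi.single_apply, hf.eq_iff, hb']
      · intro j
        simp [Pi.single_apply, hg.eq_iff, ha']

theorem exists_x {F : Type*} [Field F] {N k : ℕ} {C : Matrix (Fin N) (Fin N) F}
    (hs : C.IsSymm) (hC : NZ k C) (P : Fin N → Prop)
    (hP : ∀ f : Fin (k + 1) → Fin N, Function.Injective f → ∃ a, P (f a))
    (f g : Fin (k + 1) → Fin (N + 1)) (h : QP f g) :
    ∃ x : Fin N → F, (∀ i, ¬ P i → x i = 0) ∧ ((bm C x).submatrix f g).det ≠ 0 := by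
  rcases fin_decomp f h.1 with ⟨f', rfl⟩ | ⟨σ, f', hf'⟩ <;>
  rcases fin_decomp g h.2.1 with ⟨g', rfl⟩ | ⟨τ, g', hg'⟩
  · exact exists_x_none hC P hP f' g' ((QP.succ_iff _ _).1 h)
  · have h' := h.symm.perm τ 1
    rw [hg'] at h'
    obtain ⟨x, hx, hd⟩ := exists_x_row hC P hP _ _ h'
    refine ⟨x, hx, ?_⟩
    rw [← Matrix.det_transpose, Matrix.transpose_submatrix, (bm_symm C x hs).eq]
    rw [← hg'] at hd
    rw [Ne, ← det_perm_ne _ _ _ τ 1]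
    exact hd
  · have h' := h.perm σ 1
    rw [hf'] at h'
    obtain ⟨x, hx, hd⟩ := exists_x_row hC P hP _ _ h'
    refine ⟨x, hx, ?_⟩
    rw [← hf'] at hd
    rw [Ne, ← det_perm_ne _ _ _ σ 1]
    exact hd
  · have h' := h.perm σ τ
    rw [hf', hg', QP.cons_iff] at h'
    refine ⟨0, by simp, ?_⟩
    rw [Ne, ← det_perm_ne _ _ _ σ τ, hf', hg', det_both]
    exact hC _ _ h'

theorem generic_point {F σ ι : Type*} [Field F] [Infinite F] [Finite ι]
    (p : ι → MvPolynomial σ F) (h : ∀ i, ∃ x, MvPolynomial.eval x (p i) ≠ 0) :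
    ∃ x, ∀ i, MvPolynomial.eval x (p i) ≠ 0 := by
  have := Fintype.ofFinite ι
  have h1 : ∏ i, p i ≠ 0 := by
    rw [Finset.prod_ne_zero_iff]
    intro i _ hi
    obtain ⟨x, hx⟩ := h i
    simp [hi] at hx
  by_contra hcon
  push Not at hcon
  apply h1
  apply MvPolynomial.funext
  intro x
  obtain ⟨i, hi⟩ := hcon x
  rw [map_prod, map_zero]
  exact Finset.prod_eq_zero (Finset.mem_univ i) hi

theorem exists_common {F : Type*} [Field F] [Infinite F] {N n : ℕ}
    {C : Matrix (Fin N) (Fin N) F} (hs : C.IsSymm) (q : ℕ → Prop) (P : Fin N → Prop)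
    (hC : ∀ k < n, q k → NZ k C)
    (hP : ∀ k < n, q k → ∀ f : Fin (k + 1) → Fin N, Function.Injective f → ∃ a, P (f a)) :
    ∃ x : Fin N → F, (∀ i, ¬ P i → x i = 0) ∧ ∀ k < n, q k → NZ (k + 1) (bm C x) := by
  classical
  let y : Fin N → MvPolynomial (Fin N) F := fun i => if P i then MvPolynomial.X i else 0
  let ev : (Fin N → F) → Fin N → F := fun x i => if P i then x i else 0
  let ι := {s : Σ k : Fin n, (Fin (k + 1) → Fin (N + 1)) × (Fin (k + 1) → Fin (N + 1)) //
    q s.1 ∧ QP s.2.1 s.2.2}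
  have hev : ∀ (x : Fin N → F) (k : ℕ) (f g : Fin k → Fin (N + 1)),
      MvPolynomial.eval x ((bm (C.map MvPolynomial.C) y).submatrix f g).det =
        ((bm C (ev x)).submatrix f g).det := by
    intro x k f g
    rw [RingHom.map_det]
    congr 1
    ext i j
    simp only [RingHom.mapMatrix_apply, Matrix.map_apply, Matrix.submatrix_apply]
    have hy : ∀ i, MvPolynomial.eval x (y i) = ev x i := by
      intro i
      simp only [y, ev]
      split_ifs <;> simp
    generalize f i = u
    generalize g j = v
    refine Fin.cases ?_ (fun i => ?_) u <;> refine Fin.cases ?_ (fun j => ?_) v <;> simp [hy]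
  obtain ⟨x, hx⟩ := generic_point (ι := ι)
    (fun s => ((bm (C.map MvPolynomial.C) y).submatrix s.1.2.1 s.1.2.2).det) (by
      rintro ⟨⟨k, f, g⟩, hq, hqp⟩
      obtain ⟨x, hx, hd⟩ := exists_x hs (hC k k.2 hq) P (hP k k.2 hq) f g hqp
      refine ⟨x, ?_⟩
      rw [hev]
      have : ev x = x := by
        ext i
        simp only [ev]
        split_ifs with h
        · rfl
        · exact (hx i h).symm
      rwa [this])
  refine ⟨ev x, ?_, ?_⟩
  · intro i hi
    simp [ev, hi]
  · intro k hk hq f g hqp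
    rw [← hev]
    exact hx ⟨⟨⟨k, hk⟩, f, g⟩, hq, hqp⟩

theorem QP.one {m : Type*} (f g : Fin (0 + 1) → m) : QP f g := by
  have h : ∀ i i' : Fin (0 + 1), i = i' := fun i i' => by omega
  exact ⟨fun i i' _ => h i i', fun i i' _ => h i i', fun i i' hi => absurd (h i i') hi,
    fun i l hi => absurd (h i l) hi⟩

/-- The main construction. -/
theorem main_exists {F : Type*} [Field F] [Infinite F] (n : ℕ) : ∀ (N : ℕ), n < N →
    ∀ q : ℕ → Prop, ∃ B : Matrix (Fin N) (Fin N) F, B.IsSymm ∧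
      (∃ (V : Matrix (Fin N) (Fin n) F) (W : Matrix (Fin n) (Fin N) F), B = V * W) ∧
      ∀ k < n, (q k → NZ (k + 1) B) ∧
        (¬ q k → (∃ f g : Fin (k + 1) → Fin N, QP f g ∧ (B.submatrix f g).det = 0) ∧
          ∃ f g : Fin (k + 1) → Fin N, QP f g ∧ (B.submatrix f g).det ≠ 0) := by
  induction n with
  | zero =>
    intro N _ q
    refine ⟨0, by simp [Matrix.IsSymm], ⟨0, 0, by simp⟩, by simp⟩
  | succ n ih =>
    intro N hN q
    obtain ⟨M, rfl⟩ : ∃ M, N = M + 1 := ⟨N - 1, by omega⟩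
    obtain ⟨C, hs, ⟨V, W, hVW⟩, hC⟩ := ih M (by omega) (fun k => q (k + 1))
    let i0 : Fin M := ⟨0, by omega⟩
    obtain ⟨x, hx0, hx⟩ := exists_common (n := n + 1) hs q (fun i => q 0 ∨ i ≠ i0)
      (by
        intro k hk hq
        cases k with
        | zero =>
          intro f g _
          simp
        | succ k => exact (hC k (by omega)).1 hq)
      (by
        intro k hk hq f hf
        cases k with
        | zero => exact ⟨0, Or.inl hq⟩
        | succ k =>
          by_cases h : f 0 = i0
          · refine ⟨1, Or.inr fun h1 => ?_⟩
            have := hf (h.trans h1.symm)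
            simp at this
          · exact ⟨0, Or.inr h⟩)
    refine ⟨bm C x, bm_symm C x hs, ?_, ?_⟩
    · refine ⟨Matrix.of fun i j => Fin.cases (Fin.cases 1 x i)
          (fun j' => Fin.cases 0 (fun i' => V i' j') i) j,
        Matrix.of fun j i => Fin.cases (Fin.cases 1 x i)
          (fun j' => Fin.cases 0 (fun i' => W j' i') i) j, ?_⟩
      ext i j
      rw [Matrix.mul_apply, Fin.sum_univ_succ]
      refine Fin.cases ?_ (fun i => ?_) i <;> refine Fin.cases ?_ (fun j => ?_) j <;>
        simp [hVW, Matrix.mul_apply, add_comm]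
    · intro k hk
      refine ⟨hx k hk, fun hq => ?_⟩
      cases k with
      | zero =>
        refine ⟨⟨fun _ => 0, fun _ => i0.succ, ?_, ?_⟩, ⟨fun _ => 0, fun _ => 0, ?_, ?_⟩⟩
        · exact QP.one _ _
        · simp
          exact hx0 i0 (by simp [hq])
        · exact QP.one _ _
        · simp
      | succ k =>
        obtain ⟨⟨f, g, h1, h2⟩, f', g', h3, h4⟩ := (hC k (by omega)).2 hq
        exact ⟨⟨_, _, (QP.cons_iff f g).2 h1, by rwa [det_both]⟩,
          ⟨_, _, (QP.cons_iff f' g').2 h3, by rwa [det_both]⟩⟩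

theorem exists_perm {k : ℕ} {m : Type*} {f e : Fin k → m} (hf : Function.Injective f)
    (h : ∀ i, ∃ j, e j = f i) : ∃ σ : Equiv.Perm (Fin k), f = e ∘ σ := by
  choose σ hσ using h
  have hi : Function.Injective σ := by
    intro i j hij
    apply hf
    rw [← hσ, ← hσ, hij]
  exact ⟨Equiv.ofBijective σ (Finite.injective_iff_bijective.1 hi), by ext1 i; simp [hσ]⟩

theorem qMinor_eq_zero_iff {R : Type*} [CommRing R] {m : Type*} [Fintype m] [LinearOrder m]
    (B : Matrix m m R) {k : ℕ} (f g : Fin k → m) (hf : Function.Injective f)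
    (hg : Function.Injective g) (α β : Finset m) (hα : α = Finset.univ.image f)
    (hβ : β = Finset.univ.image g) :
    qMinor B α β = 0 ↔ (B.submatrix f g).det = 0 := by
  have h1 : α.card = k := by rw [hα, Finset.card_image_of_injective _ hf]; simp
  have h2 : β.card = k := by rw [hβ, Finset.card_image_of_injective _ hg]; simp
  subst h1
  rw [qMinor, dif_pos h2]
  obtain ⟨σ, hσ⟩ := exists_perm (e := α.orderEmbOfFin rfl) hf (by
    intro i
    have : f i ∈ Set.range (α.orderEmbOfFin rfl) := by
      rw [Finset.range_orderEmbOfFin, hα]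
      simp
    exact this)
  obtain ⟨τ, hτ⟩ := exists_perm (e := β.orderEmbOfFin h2) hg (by
    intro i
    have : g i ∈ Set.range (β.orderEmbOfFin h2) := by
      rw [Finset.range_orderEmbOfFin, hβ]
      simp
    exact this)
  have := det_perm_ne B (α.orderEmbOfFin rfl) (β.orderEmbOfFin h2) σ τ
  rw [← hσ, ← hτ] at this
  rw [this]
  rfl

theorem Sub1.of_card {k : ℕ} {m : Type*} [DecidableEq m] {f g : Fin k → m}
    (hf : Function.Injective f)
    (h : (Finset.univ.image f \ Finset.univ.image g).card ≤ 1) : Sub1 f g := by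
  intro i i' hi
  by_contra hcon
  push Not at hcon
  apply hi
  apply hf
  rw [Finset.card_le_one] at h
  apply h
  · simpa using hcon.1
  · simpa using hcon.2

theorem Sub1.card {k : ℕ} {m : Type*} [DecidableEq m] {f g : Fin k → m}
    (h : Sub1 f g) : (Finset.univ.image f \ Finset.univ.image g).card ≤ 1 := by
  rw [Finset.card_le_one]
  intro a ha b hb
  simp only [Finset.mem_sdiff, Finset.mem_image, Finset.mem_univ, true_and] at ha hb
  obtain ⟨⟨i, rfl⟩, hi⟩ := ha
  obtain ⟨⟨i', rfl⟩, hi'⟩ := hb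
  by_contra hne
  rcases h i i' (fun h => hne (by rw [h])) with h | h
  · exact hi h
  · exact hi' h

theorem QP.isQPPair {k : ℕ} {m : Type*} [DecidableEq m] {f g : Fin k → m} (h : QP f g) :
    IsQPPair k (Finset.univ.image f) (Finset.univ.image g) := by
  have h1 : (Finset.univ.image f).card = k := by
    rw [Finset.card_image_of_injective _ h.1]; simp
  have h2 : (Finset.univ.image g).card = k := by
    rw [Finset.card_image_of_injective _ h.2.1]; simp
  refine ⟨h1, h2, ?_⟩
  have := h.2.2.1.card
  have h3 := Finset.card_inter_add_card_sdiff (Finset.univ.image f) (Finset.univ.image g)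
  omega

theorem IsQPPair.exists_QP {k : ℕ} {m : Type*} [LinearOrder m] {α β : Finset m}
    (h : IsQPPair k α β) : ∃ f g : Fin k → m, QP f g ∧ α = Finset.univ.image f ∧
      β = Finset.univ.image g := by
  obtain ⟨h1, h2, h3⟩ := h
  have hα : α = Finset.univ.image (α.orderEmbOfFin h1) := by
    apply Finset.coe_injective
    simp
  have hβ : β = Finset.univ.image (β.orderEmbOfFin h2) := by
    apply Finset.coe_injective
    simp
  refine ⟨α.orderEmbOfFin h1, β.orderEmbOfFin h2, ⟨?_, ?_, ?_, ?_⟩, hα, hβ⟩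
  · exact (α.orderEmbOfFin h1).injective
  · exact (β.orderEmbOfFin h2).injective
  · apply Sub1.of_card (α.orderEmbOfFin h1).injective
    rw [← hα, ← hβ]
    have := Finset.card_inter_add_card_sdiff α β
    omega
  · apply Sub1.of_card (β.orderEmbOfFin h2).injective
    rw [← hα, ← hβ]
    have := Finset.card_inter_add_card_sdiff β α
    rw [Finset.inter_comm] at this
    omega

theorem qpAllNonzero_iff {R : Type*} [CommRing R] {m : Type*} [Fintype m] [LinearOrder m]
    (B : Matrix m m R) (k : ℕ) : QPAllNonzero B k ↔ NZ k B := by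
  constructor
  · intro h f g hqp h0
    exact h _ _ hqp.isQPPair ((qMinor_eq_zero_iff B f g hqp.1 hqp.2.1 _ _ rfl rfl).2 h0)
  · intro h α β hqp h0
    obtain ⟨f, g, hfg, hα, hβ⟩ := hqp.exists_QP
    exact h f g hfg ((qMinor_eq_zero_iff B f g hfg.1 hfg.2.1 _ _ hα hβ).1 h0)

theorem qpAllZero_iff {R : Type*} [CommRing R] {m : Type*} [Fintype m] [LinearOrder m]
    (B : Matrix m m R) (k : ℕ) :
    QPAllZero B k ↔ ∀ f g : Fin k → m, QP f g → (B.submatrix f g).det = 0 := by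
  constructor
  · intro h f g hqp
    exact (qMinor_eq_zero_iff B f g hqp.1 hqp.2.1 _ _ rfl rfl).1 (h _ _ hqp.isQPPair)
  · intro h α β hqp
    obtain ⟨f, g, hfg, hα, hβ⟩ := hqp.exists_QP
    exact (qMinor_eq_zero_iff B f g hfg.1 hfg.2.1 _ _ hα hβ).2 (h f g hfg)

theorem QP.refl {k : ℕ} {m : Type*} {f : Fin k → m} (h : Function.Injective f) : QP f f :=
  ⟨h, h, fun i _ _ => Or.inl ⟨i, rfl⟩, fun i _ _ => Or.inl ⟨i, rfl⟩⟩

theorem det_eq_zero_of_factor {F : Type*} [Field F] {n N k : ℕ} (hk : n < k)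
    (V : Matrix (Fin N) (Fin n) F) (W : Matrix (Fin n) (Fin N) F) (f g : Fin k → Fin N) :
    ((V * W).submatrix f g).det = 0 := by
  by_contra h
  have h1 : IsUnit ((V * W).submatrix f g) := by
    rw [Matrix.isUnit_iff_isUnit_det]
    exact isUnit_iff_ne_zero.2 h
  have h2 := Matrix.rank_of_isUnit _ h1
  have h3 := Matrix.rank_submatrix_le (V * W) f g
  have h4 := Matrix.rank_mul_le_left V W
  have h5 := V.rank_le_width
  rw [Fintype.card_fin] at h2
  omega

/-- over a field of characteristic 0, for any sequence `q_1 ⋯ q_n` with all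
terms in `{A, S}` and any `t ≥ 1`, the length-`(n + t)` sequence `q_1 ⋯ q_n N ⋯ N`
(with `t` copies of `N`) is attainable. -/
theorem stmt_4 {F : Type*} [Field F] [CharZero F] {n t : ℕ} (ht : 1 ≤ t)
    (q : Fin n → QPR) (hq : ∀ k : Fin n, q k = QPR.A ∨ q k = QPR.S) :
    Attainable F (fun k : Fin (n + t) =>
      if h : (k : ℕ) < n then q ⟨(k : ℕ), h⟩ else QPR.N) := by
  obtain ⟨B, hs, ⟨V, W, hVW⟩, hB⟩ := main_exists (F := F) n (n + t) (by omega)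
    (fun k => ∃ h : k < n, q ⟨k, h⟩ = QPR.A)
  refine ⟨B, hs, fun k => ?_⟩
  unfold qprEntry
  rw [qpAllNonzero_iff, qpAllZero_iff]
  beta_reduce
  by_cases hk : (k : ℕ) < n
  · rw [dif_pos hk]
    obtain ⟨hA, hS⟩ := hB k hk
    rcases hq ⟨k, hk⟩ with h | h
    · rw [if_pos (hA ⟨hk, h⟩), h]
    · obtain ⟨⟨f, g, h1, h2⟩, f', g', h3, h4⟩ := hS (by rintro ⟨_, h'⟩; simp [h] at h')
      rw [if_neg (fun hn => hn f g h1 h2), if_neg (fun hn => h4 (hn f' g' h3)), h]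
  · rw [dif_neg hk]
    have hz : ∀ f g : Fin ((k : ℕ) + 1) → Fin (n + t), (B.submatrix f g).det = 0 := by
      intro f g
      rw [hVW]
      exact det_eq_zero_of_factor (by omega) V W f g
    rw [if_neg, if_pos (fun f g _ => hz f g)]
    intro hn
    exact hn _ _ (QP.refl (Fin.castLE_injective (show (k : ℕ) + 1 ≤ n + t by omega))) (hz _ _)
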